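/- Let Jac be the solution space of a Jacobi equation J'' + R(t)J = 0 with symmetric R(t), let W ⊆ Λ ⊆ Jac with W isotropic and Λ Lagrangian for the canonical symplectic form. Suppose no point of the open interval (a,b) is W-focal. Then the following are equivalent: (1) every J ∈ Λ with J(t₀) ∈ W(t₀) for some t₀ ∈ (a,b) belongs to W; (2) ind_Λ((a,b)) = ind_W((a,b)), where ind denotes the sum of focal indices over the interval. -/

import Mathlib

open Module RealInnerProductSpace

noncomputable section

/-- `J` is a (normal) Jacobi field for the family of operators `R`, i.e. a `C²`
solution of the Jacobi equation `J'' + R(t) J = 0`. -/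
def IsJacobiField {E : Type*} [NormedAddCommGroup E] [NormedSpace ℝ E]
    (R : ℝ → E →ₗ[ℝ] E) (J : ℝ → E) : Prop :=
  ContDiff ℝ 2 J ∧ ∀ t : ℝ, deriv (deriv J) t = - R t (J t)

/-- `W(t)`: the image of an evaluation map on a space of functions at time `t`. -/
def evalAt {E : Type*} [NormedAddCommGroup E] [NormedSpace ℝ E] (t : ℝ)
    (W : Submodule ℝ (ℝ → E)) : Submodule ℝ E :=
  W.map (LinearMap.proj t : (ℝ → E) →ₗ[ℝ] E)

open Filter Topology in
lemma jacobi_unique {E : Type*} [NormedAddCommGroup E]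
    [InnerProductSpace ℝ E] [FiniteDimensional ℝ E] (R : ℝ → E →ₗ[ℝ] E)
    (hRcont : Continuous fun p : ℝ × E => R p.1 p.2) (J : ℝ → E)
    (hJ : IsJacobiField R J) (t₀ : ℝ) (h0 : J t₀ = 0) (h1 : deriv J t₀ = 0) : J = 0 := by
  obtain ⟨hc, hode⟩ := hJ
  have hd : Differentiable ℝ J := hc.differentiable (by norm_num)
  have hc1 : ContDiff ℝ 1 (deriv J) := by
    have : ContDiff ℝ (1 + 1) J := by simpa [one_add_one_eq_two] using hc
    exact (contDiff_succ_iff_deriv.1 this).2.2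
  have hd1 : Differentiable ℝ (deriv J) := hc1.differentiable (by norm_num)
  funext t
  set l := min t t₀ - 1 with hl
  set r := max t t₀ + 1 with hr
  have htl : t ∈ Set.Ioo l r := by
    constructor
    · have := min_le_left t t₀; linarith
    · have := le_max_left t t₀; linarith
  have ht0 : t₀ ∈ Set.Ioo l r := by
    constructor
    · have := min_le_right t t₀; linarith
    · have := le_max_right t t₀; linarith
  have hcomp : IsCompact (Set.Icc l r ×ˢ Metric.closedBall (0 : E) 1) :=
    isCompact_Icc.prod (isCompact_closedBall _ _)
  obtain ⟨C, hC⟩ := hcomp.exists_bound_of_continuousOn hRcont.continuousOn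
  have hbd : ∀ s ∈ Set.Ioo l r, ∀ x : E, ‖R s x‖ ≤ C * ‖x‖ := by
    intro s hs x
    by_cases hx : x = 0
    · simp [hx]
    have hx' : ‖x‖ ≠ 0 := by simpa using hx
    have h := hC (s, ‖x‖⁻¹ • x) ⟨⟨hs.1.le, hs.2.le⟩, by
      simp [norm_smul, hx']⟩
    simp only [map_smul, norm_smul, norm_inv, norm_norm] at h
    have hp : 0 < ‖x‖ := norm_pos_iff.2 hx
    rwa [inv_mul_le_iff₀ hp, mul_comm] at h
  have key := ODE_solution_unique_of_mem_Ioo (K := max 1 C.toNNReal)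
    (v := fun s (p : E × E) => (p.2, - R s p.1)) (s := fun _ => Set.univ)
    (f := fun s => (J s, deriv J s)) (g := fun _ => (0 : E × E)) (a := l) (b := r) (t₀ := t₀)
    (by
      intro s hs
      apply LipschitzWith.lipschitzOnWith
      apply LipschitzWith.prodMk
      · exact LipschitzWith.prod_snd
      · apply LipschitzWith.of_dist_le_mul
        intro p q
        rw [dist_neg_neg, dist_eq_norm, dist_eq_norm, ← map_sub]
        refine (hbd s hs _).trans ?_
        have h1 : ‖p.1 - q.1‖ ≤ ‖p - q‖ := norm_fst_le (p - q)
        calc C * ‖p.1 - q.1‖ ≤ (C.toNNReal : ℝ) * ‖p.1 - q.1‖ := by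
              gcongr; exact Real.le_coe_toNNReal C
          _ ≤ _ := by gcongr)
    ht0
    (by
      intro s hs
      refine ⟨?_, trivial⟩
      have h2 := (hd1 s).hasDerivAt
      rw [hode s] at h2
      exact (hd s).hasDerivAt.prodMk h2)
    (by
      intro s hs
      refine ⟨?_, trivial⟩
      simpa [← Prod.zero_eq_mk] using hasDerivAt_const s (0 : E × E))
    (by simp [h0, h1])
  have := key htl
  simpa using congrArg Prod.fst this

open Filter Topology in
lemma jacobi_isolated {E : Type*} [NormedAddCommGroup E]
    [InnerProductSpace ℝ E] [FiniteDimensional ℝ E] (R : ℝ → E →ₗ[ℝ] E)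
    (hRcont : Continuous fun p : ℝ × E => R p.1 p.2)
    (Λ : Submodule ℝ (ℝ → E)) [FiniteDimensional ℝ Λ]
    (hsol : ∀ J ∈ Λ, IsJacobiField R J)
    (hisoΛ : ∀ J₁ ∈ Λ, ∀ J₂ ∈ Λ, ∀ t : ℝ,
      (⟪deriv J₁ t, J₂ t⟫ : ℝ) - ⟪J₁ t, deriv J₂ t⟫ = 0) (t₀ : ℝ) :
    ∀ᶠ t in 𝓝[≠] t₀, ∀ J ∈ Λ, J t = 0 → J = 0 := by
  have hd : ∀ J ∈ Λ, Differentiable ℝ J := fun J hJ =>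
    (hsol J hJ).1.differentiable (by norm_num)
  have hc1 : ∀ J ∈ Λ, Continuous (deriv J) := fun J hJ =>
    (hsol J hJ).1.continuous_deriv (by norm_num)
  let B := Module.finBasis ℝ Λ
  let F : (Fin (finrank ℝ Λ) → ℝ) → Λ := fun c => ∑ i, c i • B i
  have hF : ∀ c t, (F c : ℝ → E) t = ∑ i, c i • (B i : ℝ → E) t := by
    intro c t; simp [F, Finset.sum_apply]
  have hFd : ∀ c t, deriv (F c : ℝ → E) t = ∑ i, c i • deriv (B i : ℝ → E) t := by
    intro c t
    have : (F c : ℝ → E) = fun t => ∑ i, c i • (B i : ℝ → E) t := funext (hF c)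
    rw [this]
    apply HasDerivAt.deriv
    apply HasDerivAt.fun_sum
    intro i _
    exact ((hd _ (B i).2 t).hasDerivAt).const_smul (c i)
  have hF0 : ∀ c, (F c : ℝ → E) = 0 → c = 0 := by
    intro c h
    have h' : F c = 0 := Subtype.ext h
    funext i
    exact Fintype.linearIndependent_iff.1 B.linearIndependent c h' i
  have cF : Continuous fun p : ℝ × (Fin (finrank ℝ Λ) → ℝ) => (F p.2 : ℝ → E) p.1 := by
    simp only [hF]
    refine continuous_finsetSum _ fun i _ => ?_
    exact ((continuous_apply i).comp continuous_snd).smul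
      ((hd _ (B i).2).continuous.comp continuous_fst)
  have cFd : Continuous fun p : ℝ × (Fin (finrank ℝ Λ) → ℝ) =>
      deriv (F p.2 : ℝ → E) p.1 := by
    simp only [hFd]
    refine continuous_finsetSum _ fun i _ => ?_
    exact ((continuous_apply i).comp continuous_snd).smul
      ((hc1 _ (B i).2).comp continuous_fst)
  have key : ∀ᶠ t in 𝓝 t₀, ∀ c ∈ Metric.sphere (0 : Fin (finrank ℝ Λ) → ℝ) 1,
      t ≠ t₀ → (F c : ℝ → E) t ≠ 0 := by
    apply (isCompact_sphere _ _).eventually_forall_of_forall_eventually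
    intro c hc
    by_cases h0 : (F c : ℝ → E) t₀ = 0
    · have hK : deriv (F c : ℝ → E) t₀ ≠ 0 := by
        intro h1
        have := hF0 c (jacobi_unique R hRcont _ (hsol _ (F c).2) t₀ h0 h1)
        simp [this] at hc
      have cS : ContinuousAt (dslope (F c : ℝ → E) t₀) t₀ :=
        continuousAt_dslope_same.2 (hd _ (F c).2 t₀)
      have cg : ContinuousAt (fun p : ℝ × (Fin (finrank ℝ Λ) → ℝ) =>
          (⟪deriv (F p.2 : ℝ → E) p.1, dslope (F c : ℝ → E) t₀ p.1⟫ : ℝ)) (t₀, c) := by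
        refine ContinuousAt.inner (𝕜 := ℝ) cFd.continuousAt ?_
        exact ContinuousAt.comp (f := Prod.fst) (x := (t₀, c)) cS continuousAt_fst
      have hne := cg.eventually_ne (y := 0) (by simpa [dslope_same] using hK)
      filter_upwards [hne] with p hp hpt hz
      apply hp
      have h := hisoΛ _ (F p.2).2 _ (F c).2 p.1
      rw [hz, inner_zero_left, sub_zero] at h
      rw [dslope_of_ne _ hpt, slope_def_module, h0, sub_zero, inner_smul_right, h, mul_zero]
    · filter_upwards [cF.continuousAt.eventually_ne (x := (t₀, c)) h0] with p hp _
      exact hp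
  rw [eventually_nhdsWithin_iff]
  filter_upwards [key] with t ht htne J hJ hJt
  by_contra hJ0
  set c : Fin (finrank ℝ Λ) → ℝ := ⇑(B.repr ⟨J, hJ⟩) with hcdef
  have hFc : F c = ⟨J, hJ⟩ := B.sum_repr ⟨J, hJ⟩
  have hc0 : c ≠ 0 := by
    intro h
    apply hJ0
    have : F c = 0 := by rw [h]; simp [F]
    rw [hFc] at this
    exact congrArg Subtype.val this
  have hcn : ‖c‖ ≠ 0 := norm_ne_zero_iff.2 hc0
  refine ht (‖c‖⁻¹ • c) (by simp [norm_smul, hcn]) htne ?_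
  have h3 : (F c : ℝ → E) t = 0 := by rw [hFc]; exact hJt
  rw [hF] at h3 ⊢
  simp only [Pi.smul_apply, smul_eq_mul, mul_smul, ← Finset.smul_sum, h3, smul_zero]

/-- Evaluation has full rank iff it is injective. -/
lemma finrank_evalAt_eq_iff {E : Type*} [NormedAddCommGroup E] [NormedSpace ℝ E]
    (U : Submodule ℝ (ℝ → E)) [FiniteDimensional ℝ U] (t : ℝ) :
    finrank ℝ (evalAt t U) = finrank ℝ U ↔ ∀ J ∈ U, J t = 0 → J = 0 := by
  let f : U →ₗ[ℝ] E := (LinearMap.proj t : (ℝ → E) →ₗ[ℝ] E).comp U.subtype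
  have hr : LinearMap.range f = evalAt t U := by
    rw [LinearMap.range_comp, Submodule.range_subtype]; rfl
  have h := f.finrank_range_add_finrank_ker
  rw [hr] at h
  have : finrank ℝ (evalAt t U) = finrank ℝ U ↔ finrank ℝ (LinearMap.ker f) = 0 := by omega
  rw [this, Submodule.finrank_eq_zero, LinearMap.ker_eq_bot']
  constructor
  · intro h J hJ h0
    exact congrArg Subtype.val (h ⟨J, hJ⟩ h0)
  · intro h J h0
    exact Subtype.ext (h J J.2 h0)

lemma finrank_evalAt_le {E : Type*} [NormedAddCommGroup E] [NormedSpace ℝ E]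
    (U : Submodule ℝ (ℝ → E)) [FiniteDimensional ℝ U] (t : ℝ) :
    finrank ℝ (evalAt t U) ≤ finrank ℝ U := Submodule.finrank_map_le _ _

/-- Let `W ⊆ Λ` be spaces of Jacobi fields, `W` isotropic and `Λ` Lagrangian, with no
`W`-focal point on `(a,b)`. Then: every `J ∈ Λ` with `J(t₀) ∈ W(t₀)` for some `t₀ ∈ (a,b)`
belongs to `W`, if and only if `ind_Λ((a,b)) = ind_W((a,b))` (sums of focal indices). -/
theorem no_horizontal_conjugate_iff_index_eq {E : Type*} [NormedAddCommGroup E]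
    [InnerProductSpace ℝ E] [FiniteDimensional ℝ E] (R : ℝ → E →ₗ[ℝ] E)
    (hRcont : Continuous fun p : ℝ × E => R p.1 p.2)
    (hRsym : ∀ t : ℝ, (R t).IsSymmetric)
    (W Λ : Submodule ℝ (ℝ → E)) (hWΛ : W ≤ Λ)
    (hsol : ∀ J ∈ Λ, IsJacobiField R J)
    (hisoΛ : ∀ J₁ ∈ Λ, ∀ J₂ ∈ Λ, ∀ t : ℝ,
      (⟪deriv J₁ t, J₂ t⟫ : ℝ) - ⟪J₁ t, deriv J₂ t⟫ = 0)
    (hdimΛ : finrank ℝ Λ = finrank ℝ E)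
    (a b : ℝ)
    (hnofocal : ∀ t ∈ Set.Ioo a b, finrank ℝ (evalAt t W) = finrank ℝ W) :
    (∀ J ∈ Λ, ∀ t₀ ∈ Set.Ioo a b, J t₀ ∈ evalAt t₀ W → J ∈ W) ↔
      (∑ᶠ t ∈ Set.Ioo a b, (finrank ℝ Λ - finrank ℝ (evalAt t Λ)))
        = ∑ᶠ t ∈ Set.Ioo a b, (finrank ℝ W - finrank ℝ (evalAt t W)) := by
  have hfd : FiniteDimensional ℝ Λ := by
    rcases Nat.eq_zero_or_pos (finrank ℝ E) with h | h
    · have : Subsingleton E := Module.finrank_zero_iff.1 h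
      infer_instance
    · exact Module.finite_of_finrank_pos (hdimΛ ▸ h)
  have hfdW : FiniteDimensional ℝ W := Submodule.finiteDimensional_of_le hWΛ
  have hW0 : (∑ᶠ t ∈ Set.Ioo a b, (finrank ℝ W - finrank ℝ (evalAt t W))) = 0 := by
    apply finsum_mem_eq_zero_of_forall_eq_zero
    intro t ht
    rw [hnofocal t ht, Nat.sub_self]
  rw [hW0]
  constructor
  · intro h
    apply finsum_mem_eq_zero_of_forall_eq_zero
    intro t ht
    rw [(finrank_evalAt_eq_iff Λ t).2, Nat.sub_self]
    intro J hJ h0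
    have hJW : J ∈ W := h J hJ t ht (by rw [h0]; exact Submodule.zero_mem _)
    exact (finrank_evalAt_eq_iff W t).1 (hnofocal t ht) J hJW h0
  · intro h J hJ t₀ ht₀ hJt
    set S : Set ℝ := Set.Ioo a b ∩
      Function.support (fun t => finrank ℝ Λ - finrank ℝ (evalAt t Λ)) with hS
    have hfin : S.Finite := by
      by_contra hinf
      obtain ⟨x, -, hx⟩ := Set.Infinite.exists_accPt_of_subset_isCompact hinf
        (isCompact_Icc (a := a) (b := b))
        (Set.inter_subset_left.trans Set.Ioo_subset_Icc_self)
      rw [accPt_iff_frequently_nhdsNE] at hx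
      apply hx
      filter_upwards [jacobi_isolated R hRcont Λ hsol hisoΛ x] with t ht htS
      apply htS.2
      simp only
      rw [(finrank_evalAt_eq_iff Λ t).2 ht, Nat.sub_self]
    have hz : finrank ℝ Λ - finrank ℝ (evalAt t₀ Λ) = 0 := by
      rw [← finsum_mem_inter_support, finsum_mem_eq_finite_toFinset_sum _ hfin,
        Finset.sum_eq_zero_iff] at h
      by_contra hne
      exact hne (h t₀ (by rw [Set.Finite.mem_toFinset]; exact ⟨ht₀, hne⟩))
    have hinj := (finrank_evalAt_eq_iff Λ t₀).1
      (le_antisymm (finrank_evalAt_le Λ t₀) (Nat.sub_eq_zero_iff_le.1 hz))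
    obtain ⟨w, hw, hwt⟩ := hJt
    have hwt' : w t₀ = J t₀ := hwt
    have := hinj (J - w) (Λ.sub_mem hJ (hWΛ hw)) (by simp [hwt'])
    rw [sub_eq_zero.1 this]
    exact hw
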